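/- arXiv:2505.10126 — 6 statements merged into one kernel-verified Lean document; each statement's English description precedes it below -/
import Mathlib

section
/- In the setting above, assume β ∈ (0,1] and p_n(D∣i,𝐚) ≥ β for every i ∈ S∖D and 𝐚 ∈ 𝐀_n(i). Then for all functions u, v : (S∖D) × ℚ^N → ℝ with values in [0,1], every (i,λ) ∈ (S∖D) × ℚ^N, and every product distribution φ = (φ^1,…,φ^N) with each φ^l a probability mass function on A_n^l(i), one has |T_{n,k}^φ u(i,λ) − T_{n,k}^φ v(i,λ)| ≤ (1 − β) · ⨆_{(j,μ)∈(S∖D)×ℚ^N} |u(j,μ) − v(j,μ)|. -/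
open scoped BigOperators

/-- The one-step operator `T_{n,k}^𝐚 u (i, λ)` for a fixed joint action `𝐚`:
`𝟙[r_n^k(i,𝐚) ≥ λ^k] · p_n(D∣i,𝐚) + ∑_{j ∈ S∖D} u(j, λ - r_n(i,𝐚)) · p_n(j∣i,𝐚)`. -/
noncomputable def Ta {S : Type*} {N : ℕ} {α : Fin N → Type*} (D : Set S)
    (p : S → ((k : Fin N) → α k) → S → ℝ)
    (r : (k : Fin N) → S → ((k : Fin N) → α k) → ℚ)
    (k : Fin N)
    (u : {j : S // j ∉ D} → (Fin N → ℚ) → ℝ)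
    (i : {j : S // j ∉ D}) (lam : Fin N → ℚ)
    (a : (k : Fin N) → α k) : ℝ :=
  (if lam k ≤ r k (i : S) a then (1 : ℝ) else 0) * (∑' j : D, p (i : S) a (j : S)) +
    ∑' j : {j : S // j ∉ D}, u j (fun l => lam l - r l (i : S) a) * p (i : S) a (j : S)

/-- The one-step operator `T_{n,k}^φ u (i, λ)` for a product distribution
`φ = (φ^1, …, φ^N)` over the joint action set `𝐀_n(i)`. -/
noncomputable def Tphi {S : Type*} {N : ℕ} {α : Fin N → Type*}
    [∀ k, DecidableEq (α k)] (D : Set S)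
    (A : S → (k : Fin N) → Finset (α k))
    (p : S → ((k : Fin N) → α k) → S → ℝ)
    (r : (k : Fin N) → S → ((k : Fin N) → α k) → ℚ)
    (k : Fin N)
    (phi : (l : Fin N) → α l → ℝ)
    (u : {j : S // j ∉ D} → (Fin N → ℚ) → ℝ)
    (i : {j : S // j ∉ D}) (lam : Fin N → ℚ) : ℝ :=
  ∑ a ∈ Fintype.piFinset (fun l => A (i : S) l),
    Ta D p r k u i lam a * ∏ l, phi l (a l)

/-- Under Assumption B (`p_n(D∣i,𝐚) ≥ β > 0`), the operator `T_{n,k}^φ` is a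
`(1 - β)`-contraction in the sup distance on `[0,1]`-valued functions on `(S∖D) × ℚ^N`. -/
theorem stmt2 {S : Type*} [Countable S] {N : ℕ} (hN : 1 ≤ N)
    {α : Fin N → Type*} [∀ k, DecidableEq (α k)]
    (D : Set S)
    (A : S → (k : Fin N) → Finset (α k))
    (hA : ∀ i k, (A i k).Nonempty)
    (p : S → ((k : Fin N) → α k) → S → ℝ)
    (r : (k : Fin N) → S → ((k : Fin N) → α k) → ℚ)
    (hp0 : ∀ i a j, 0 ≤ p i a j)
    (hp1 : ∀ i : S, i ∉ D → ∀ a, (∀ k, a k ∈ A i k) → HasSum (p i a) 1)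
    (hr : ∀ k i a, 0 ≤ r k i a)
    (k : Fin N)
    (β : ℝ) (hβ0 : 0 < β) (hβ1 : β ≤ 1)
    (hpD : ∀ i : S, i ∉ D → ∀ a, (∀ k, a k ∈ A i k) → β ≤ ∑' j : D, p i a (j : S))
    (u v : {j : S // j ∉ D} → (Fin N → ℚ) → ℝ)
    (hu : ∀ j μ, u j μ ∈ Set.Icc (0 : ℝ) 1)
    (hv : ∀ j μ, v j μ ∈ Set.Icc (0 : ℝ) 1)
    (i : {j : S // j ∉ D}) (lam : Fin N → ℚ)
    (phi : (l : Fin N) → α l → ℝ)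
    (hphi0 : ∀ l a, 0 ≤ phi l a)
    (hphi1 : ∀ l, ∑ a ∈ A (i : S) l, phi l a = 1)
    (hphisupp : ∀ l a, a ∉ A (i : S) l → phi l a = 0) :
    |Tphi D A p r k phi u i lam - Tphi D A p r k phi v i lam| ≤
      (1 - β) * ⨆ j : {j : S // j ∉ D}, ⨆ μ : Fin N → ℚ, |u j μ - v j μ| := by
  set M := ⨆ j : {j : S // j ∉ D}, ⨆ μ : Fin N → ℚ, |u j μ - v j μ| with hM
  have hb : ∀ j μ, |u j μ - v j μ| ≤ 1 := fun j μ => by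
    have h1 := hu j μ
    have h2 := hv j μ
    rw [abs_le]
    constructor <;> linarith [h1.1, h1.2, h2.1, h2.2]
  have hle : ∀ j μ, |u j μ - v j μ| ≤ M := fun j μ => by
    have h1 : |u j μ - v j μ| ≤ ⨆ μ : Fin N → ℚ, |u j μ - v j μ| :=
      le_ciSup (f := fun μ => |u j μ - v j μ|) ⟨1, by rintro _ ⟨μ, rfl⟩; exact hb j μ⟩ μ
    refine h1.trans (le_ciSup (f := fun j => ⨆ μ : Fin N → ℚ, |u j μ - v j μ|) ⟨1, ?_⟩ j)
    rintro _ ⟨j, rfl⟩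
    exact ciSup_le (hb j)
  have hM0 : 0 ≤ M := (abs_nonneg _).trans (hle i lam)
  have key : ∀ a, (∀ k, a k ∈ A i k) →
      |Ta D p r k u i lam a - Ta D p r k v i lam a| ≤ (1 - β) * M := by
    intro a ha
    have hs := hp1 i i.2 a ha
    have hsc : Summable (fun j : {j : S // j ∉ D} => p i a j) :=
      hs.summable.comp_injective Subtype.val_injective
    have hsplit : (∑' j : D, p i a j) + ∑' j : {j : S // j ∉ D}, p i a j = 1 := by
      rw [← hs.tsum_eq]
      exact Summable.tsum_add_tsum_compl (f := p i a) (s := D)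
        (hs.summable.comp_injective Subtype.val_injective)
        (hs.summable.comp_injective Subtype.val_injective)
    have hsum : ∀ w : {j : S // j ∉ D} → (Fin N → ℚ) → ℝ,
        (∀ j μ, w j μ ∈ Set.Icc (0 : ℝ) 1) →
        Summable (fun j : {j : S // j ∉ D} => w j (fun l => lam l - r l i a) * p i a j) := by
      intro w hw
      refine Summable.of_nonneg_of_le (fun j => mul_nonneg (hw _ _).1 (hp0 _ _ _)) (fun j => ?_) hsc
      exact mul_le_of_le_one_left (hp0 _ _ _) (hw _ _).2
    unfold Ta
    rw [add_sub_add_left_eq_sub, ← (hsum u hu).tsum_sub (hsum v hv)]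
    have hbd : ∀ j : {j : S // j ∉ D}, ‖u j (fun l => lam l - r l i a) * p i a j -
        v j (fun l => lam l - r l i a) * p i a j‖ ≤ M * p i a j := fun j => by
      rw [← sub_mul, Real.norm_eq_abs, abs_mul, abs_of_nonneg (hp0 _ _ _)]
      exact mul_le_mul_of_nonneg_right (hle _ _) (hp0 _ _ _)
    have h := tsum_of_norm_bounded (hsc.hasSum.mul_left M) hbd
    rw [Real.norm_eq_abs] at h
    refine h.trans ?_
    rw [mul_comm]
    refine mul_le_mul_of_nonneg_right ?_ hM0
    linarith [hpD i i.2 a ha]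
  have hprod : ∑ a ∈ Fintype.piFinset (fun l => A (i : S) l), ∏ l, phi l (a l) = 1 := by
    rw [← Finset.prod_univ_sum]
    simp [hphi1]
  unfold Tphi
  rw [← Finset.sum_sub_distrib]
  refine (Finset.abs_sum_le_sum_abs _ _).trans ?_
  calc _ ≤ ∑ a ∈ Fintype.piFinset (fun l => A (i : S) l), ((1 - β) * M) * ∏ l, phi l (a l) := by
        refine Finset.sum_le_sum fun a ha => ?_
        have h0 : 0 ≤ ∏ l, phi l (a l) := Finset.prod_nonneg fun l _ => hphi0 _ _
        rw [← sub_mul, abs_mul, abs_of_nonneg h0]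
        exact mul_le_mul_of_nonneg_right (key a (Fintype.mem_piFinset.1 ha)) h0
    _ = (1 - β) * M := by rw [← Finset.mul_sum, hprod, mul_one]
end

section
/- Let (X_n)_{n∈ℕ} be a sequence of nonempty types, let β ∈ (0,1], and for each n let T_n : 𝒰_{n+1} → 𝒰_n be (1−β)-Lipschitz, i.e. d(T_n f, T_n g) ≤ (1−β)·d(f,g) for all f, g ∈ 𝒰_{n+1}. Then there exists exactly one sequence (u_n)_{n∈ℕ} with u_n ∈ 𝒰_n and u_n = T_n u_{n+1} for all n ∈ ℕ. -/
/-- The class `𝒰` of functions `X → ℝ` with values in `[0,1]`. -/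
abbrev UnitBall (X : Type*) := {u : X → ℝ // ∀ x, u x ∈ Set.Icc (0 : ℝ) 1}

/-- The sup distance `d(f,g) = ⨆ x, |f x - g x|`. -/
noncomputable def supDist {X : Type*} (f g : X → ℝ) : ℝ := ⨆ x, |f x - g x|

/-- Nonstationary contraction fixed-point principle: if each `T n : 𝒰_{n+1} → 𝒰_n` is
`(1-β)`-Lipschitz with `β ∈ (0,1]`, then there is exactly one sequence `(u n)` with
`u n ∈ 𝒰_n` and `u n = T n (u (n+1))` for all `n`. -/
theorem stmt4 (X : ℕ → Type*) [∀ n, Nonempty (X n)]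
    (β : ℝ) (hβ0 : 0 < β) (hβ1 : β ≤ 1)
    (T : ∀ n, UnitBall (X (n + 1)) → UnitBall (X n))
    (hT : ∀ n (f g : UnitBall (X (n + 1))),
      supDist (T n f).1 (T n g).1 ≤ (1 - β) * supDist f.1 g.1) :
    ∃! u : ∀ n, UnitBall (X n), ∀ n, u n = T n (u (n + 1)) := by
  have hr0 : 0 ≤ 1 - β := by linarith
  have hr1 : 1 - β < 1 := by linarith
  have hlim : Filter.Tendsto (fun k : ℕ => (1 - β) ^ k) Filter.atTop (nhds 0) :=
    tendsto_pow_atTop_nhds_zero_of_lt_one hr0 hr1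
  have hone : ∀ n (f g : UnitBall (X n)) x, |f.1 x - g.1 x| ≤ 1 := by
    intro n f g x
    have h1 := f.2 x
    have h2 := g.2 x
    rw [Set.mem_Icc] at h1 h2
    rw [abs_le]
    constructor <;> linarith
  have hT' : ∀ n (f g : UnitBall (X (n + 1))) (C : ℝ), (∀ x, |f.1 x - g.1 x| ≤ C) →
      ∀ x, |(T n f).1 x - (T n g).1 x| ≤ (1 - β) * C := by
    intro n f g C h x
    have hb : BddAbove (Set.range fun x => |(T n f).1 x - (T n g).1 x|) := by
      refine ⟨1, ?_⟩
      rintro _ ⟨y, rfl⟩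
      exact hone n _ _ y
    have h1 : |(T n f).1 x - (T n g).1 x| ≤ supDist (T n f).1 (T n g).1 := le_ciSup hb x
    have h2 : supDist f.1 g.1 ≤ C := ciSup_le h
    exact h1.trans ((hT n f g).trans (mul_le_mul_of_nonneg_left h2 hr0))
  let v : ℕ → ∀ n, UnitBall (X n) := fun k => Nat.rec
    (fun n => ⟨fun _ => 0, fun _ => by simp⟩) (fun _ w n => T n (w (n + 1))) k
  have hv : ∀ k n, v (k + 1) n = T n (v k (n + 1)) := fun k n => rfl
  have hd : ∀ k j n x, |(v k n).1 x - (v (k + j) n).1 x| ≤ (1 - β) ^ k := by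
    intro k
    induction k with
    | zero => intro j n x; simpa using hone n (v 0 n) (v (0 + j) n) x
    | succ k ih =>
      intro j n x
      rw [show k + 1 + j = (k + j) + 1 by ring, hv, hv, pow_succ']
      exact hT' n _ _ _ (ih j (n + 1)) x
  have hc : ∀ n x, ∃ l, Filter.Tendsto (fun k => (v k n).1 x) Filter.atTop (nhds l) := by
    intro n x
    apply cauchySeq_tendsto_of_complete
    refine cauchySeq_of_le_tendsto_0' (fun k => (1 - β) ^ k) ?_ hlim
    intro a b hab
    obtain ⟨j, rfl⟩ := Nat.exists_eq_add_of_le hab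
    exact hd a j n x
  choose l hl using hc
  let u : ∀ n, UnitBall (X n) := fun n =>
    ⟨l n, fun x => isClosed_Icc.mem_of_tendsto (hl n x)
      (Filter.Eventually.of_forall fun k => (v k n).2 x)⟩
  have hu : ∀ k n x, |(v k n).1 x - (u n).1 x| ≤ (1 - β) ^ k := by
    intro k n x
    have h1 : Filter.Tendsto (fun j => |(v k n).1 x - (v (k + j) n).1 x|) Filter.atTop
        (nhds |(v k n).1 x - l n x|) := by
      have h2 := (hl n x).comp (Filter.tendsto_add_atTop_nat k)
      have h3 := (h2.const_sub ((v k n).1 x)).abs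
      refine h3.congr fun j => ?_
      simp only [Function.comp_apply, add_comm]
    exact le_of_tendsto h1 (Filter.Eventually.of_forall fun j => hd k j n x)
  have hz : ∀ a b : ℝ, (∀ k : ℕ, |a - b| ≤ 2 * (1 - β) ^ k) → a = b := by
    intro a b h
    have h1 := ge_of_tendsto' (hlim.const_mul 2) h
    rw [mul_zero] at h1
    exact sub_eq_zero.mp (abs_nonpos_iff.mp h1)
  refine ⟨u, ?_, ?_⟩
  · intro n
    apply Subtype.ext
    funext x
    apply hz
    intro k
    have h1 := hu (k + 1) n x
    have h2 := hT' n _ _ _ (hu k (n + 1)) x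
    rw [hv, pow_succ'] at h1
    have h3 : (1 - β) * (1 - β) ^ k ≤ (1 - β) ^ k :=
      mul_le_of_le_one_left (pow_nonneg hr0 k) hr1.le
    rw [abs_le] at *
    constructor <;> linarith [h1.1, h1.2, h2.1, h2.2]
  · intro w hw
    have hwv : ∀ k n x, |(v k n).1 x - (w n).1 x| ≤ (1 - β) ^ k := by
      intro k
      induction k with
      | zero => intro n x; simpa using hone n (v 0 n) (w n) x
      | succ k ih =>
        intro n x
        rw [hw n, hv, pow_succ']
        exact hT' n _ _ _ (ih (n + 1)) x
    funext n
    apply Subtype.ext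
    funext x
    apply hz
    intro k
    have h1 := hu k n x
    have h2 := hwv k n x
    rw [abs_le] at *
    constructor <;> linarith [h1.1, h1.2, h2.1, h2.2]
end

section
/- Let (X_n)_{n∈ℕ} be a sequence of nonempty types, let β ∈ (0,1], and for each n let T_n : 𝒰_{n+1} → 𝒰_n be monotone (f ≤ g pointwise implies T_n f ≤ T_n g pointwise) and (1−β)-Lipschitz: d(T_n f, T_n g) ≤ (1−β)·d(f,g). Let (F_n) with F_n ∈ 𝒰_n satisfy F_n = T_n F_{n+1} for all n. If (u_n) with u_n ∈ 𝒰_n satisfies u_n ≤ T_n u_{n+1} pointwise for all n, then u_n ≤ F_n pointwise for all n; symmetrically, if u_n ≥ T_n u_{n+1} pointwise for all n, then u_n ≥ F_n pointwise for all n. -/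
theorem supDist_le_aux {X : Type*} [Nonempty X] (f g : X → ℝ) (c : ℝ)
    (h : ∀ x, |f x - g x| ≤ c) : supDist f g ≤ c := ciSup_le h

theorem le_supDist_aux {X : Type*} (f g : UnitBall X) (x : X) :
    |f.1 x - g.1 x| ≤ supDist f.1 g.1 := by
  refine le_ciSup (f := fun x => |f.1 x - g.1 x|) ⟨1, ?_⟩ x
  rintro _ ⟨y, rfl⟩
  have h1 := f.2 y
  have h2 := g.2 y
  simp only [Set.mem_Icc] at h1 h2
  exact abs_le.2 ⟨by linarith, by linarith⟩

theorem le_of_pow_aux (β : ℝ) (hβ0 : 0 < β) (hβ1 : β ≤ 1) (a b : ℝ)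
    (h : ∀ k : ℕ, a ≤ b + (1 - β) ^ k) : a ≤ b := by
  have ht := (tendsto_pow_atTop_nhds_zero_of_lt_one (r := 1 - β) (by linarith)
    (by linarith)).const_add b
  rw [add_zero] at ht
  exact ge_of_tendsto' ht h

/-- Abstract comparison principle: if each `T n : 𝒰_{n+1} → 𝒰_n` is monotone and
`(1-β)`-Lipschitz with `β ∈ (0,1]`, and `(F n)` satisfies `F n = T n (F (n+1))`, then any
sub-solution `u n ≤ T n (u (n+1))` satisfies `u n ≤ F n`, and any super-solution
`u n ≥ T n (u (n+1))` satisfies `u n ≥ F n`. -/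
theorem stmt5 (X : ℕ → Type*) [∀ n, Nonempty (X n)]
    (β : ℝ) (hβ0 : 0 < β) (hβ1 : β ≤ 1)
    (T : ∀ n, UnitBall (X (n + 1)) → UnitBall (X n))
    (hmono : ∀ n (f g : UnitBall (X (n + 1))),
      (∀ x, f.1 x ≤ g.1 x) → ∀ x, (T n f).1 x ≤ (T n g).1 x)
    (hT : ∀ n (f g : UnitBall (X (n + 1))),
      supDist (T n f).1 (T n g).1 ≤ (1 - β) * supDist f.1 g.1)
    (F : ∀ n, UnitBall (X n)) (hF : ∀ n, F n = T n (F (n + 1))) :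
    (∀ u : ∀ n, UnitBall (X n),
      (∀ n x, (u n).1 x ≤ (T n (u (n + 1))).1 x) → ∀ n x, (u n).1 x ≤ (F n).1 x) ∧
    (∀ u : ∀ n, UnitBall (X n),
      (∀ n x, (T n (u (n + 1))).1 x ≤ (u n).1 x) → ∀ n x, (F n).1 x ≤ (u n).1 x) := by
  have hr : 0 ≤ 1 - β := by linarith
  constructor
  · intro u hu n x
    refine le_of_pow_aux β hβ0 hβ1 _ _ fun k => ?_
    induction k generalizing n with
    | zero =>
      have h1 := ((u n).2 x).2
      have h2 := ((F n).2 x).1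
      rw [pow_zero]; linarith
    | succ k ih =>
      let g : UnitBall (X (n + 1)) := ⟨fun y => max ((u (n+1)).1 y) ((F (n+1)).1 y), fun y =>
        ⟨le_max_of_le_left ((u (n+1)).2 y).1, max_le ((u (n+1)).2 y).2 ((F (n+1)).2 y).2⟩⟩
      have hd : supDist g.1 (F (n+1)).1 ≤ (1 - β) ^ k := by
        refine supDist_le_aux _ _ _ fun y => ?_
        have h0 : (F (n+1)).1 y ≤ g.1 y := le_max_right _ _
        have h1 : g.1 y ≤ (F (n+1)).1 y + (1 - β) ^ k :=
          max_le (ih (n+1) y) (le_add_of_nonneg_right (pow_nonneg hr k))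
        exact abs_le.2 ⟨by linarith [pow_nonneg hr k], by linarith⟩
      have h1 := hu n x
      have h2 := hmono n (u (n+1)) g (fun y => le_max_left _ _) x
      have h3 := (le_abs_self _).trans (le_supDist_aux (T n g) (T n (F (n+1))) x)
      have h4 := hT n g (F (n+1))
      have h5 := mul_le_mul_of_nonneg_left hd hr
      rw [hF n, pow_succ']
      linarith
  · intro u hu n x
    refine le_of_pow_aux β hβ0 hβ1 _ _ fun k => ?_
    induction k generalizing n with
    | zero =>
      have h1 := ((u n).2 x).1
      have h2 := ((F n).2 x).2
      rw [pow_zero]; linarith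
    | succ k ih =>
      let g : UnitBall (X (n + 1)) := ⟨fun y => min ((u (n+1)).1 y) ((F (n+1)).1 y), fun y =>
        ⟨le_min ((u (n+1)).2 y).1 ((F (n+1)).2 y).1, min_le_of_left_le ((u (n+1)).2 y).2⟩⟩
      have hd : supDist (F (n+1)).1 g.1 ≤ (1 - β) ^ k := by
        refine supDist_le_aux _ _ _ fun y => ?_
        have h0 : g.1 y ≤ (F (n+1)).1 y := min_le_right _ _
        have h1 : (F (n+1)).1 y - (1 - β) ^ k ≤ g.1 y :=
          le_min (by linarith [ih (n+1) y]) (by linarith [pow_nonneg hr k])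
        exact abs_le.2 ⟨by linarith [pow_nonneg hr k], by linarith⟩
      have h1 := hu n x
      have h2 := hmono n g (u (n+1)) (fun y => min_le_left _ _) x
      have h3 := (le_abs_self _).trans (le_supDist_aux (T n (F (n+1))) (T n g) x)
      have h4 := hT n (F (n+1)) g
      have h5 := mul_le_mul_of_nonneg_left hd hr
      rw [hF n, pow_succ']
      linarith
end

section
/- In the setting above, fix a player index k ∈ {1,…,N} and, for each l ≠ k, each n ∈ ℕ and each (i,λ) ∈ (S∖D) × ℚ^N, a probability mass function φ_n^l(·∣i,λ) on A_n^l(i) (a Markov decision rule for player l). Assume there exist β_n ∈ [0,1) with ∑_{n=0}^∞ β_n = ∞ and p_n(D∣i,𝐚) ≥ β_n for all n, all i ∈ S∖D and all 𝐚 ∈ 𝐀_n(i). Then there exists a sequence (u_n)_{n∈ℕ} of functions u_n : (S∖D) × ℚ^N → ℝ with values in [0,1] such that: (i) u_n(i,λ) = 1 whenever λ^k < 0; (ii) for all n and all (i,λ), u_n(i,λ) = sup over probability mass functions φ on A_n^k(i) of T_{n,k}^{[φ_n^{−k}(·∣i,λ), φ]} u_{n+1}(i,λ); and (iii) for each n and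 (i,λ) this supremum is attained, indeed by the Dirac measure at some action a* ∈ A_n^k(i). -/
open scoped BigOperators

section Helpers

variable {S : Type*} {N : ℕ} {α : Fin N → Type*}

lemma aux_summable (D : Set S) (q : S → ℝ) (hq0 : ∀ j, 0 ≤ q j) (hq : HasSum q 1)
    (u : {j : S // j ∉ D} → ℝ) (hu : ∀ j, u j ∈ Set.Icc (0:ℝ) 1) :
    Summable (fun j : {j : S // j ∉ D} => u j * q j) := by
  have h : Summable (fun j : {j : S // j ∉ D} => q j) :=
    hq.summable.comp_injective Subtype.val_injective
  refine Summable.of_nonneg_of_le (fun j => mul_nonneg (hu j).1 (hq0 _)) (fun j => ?_) h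
  exact mul_le_of_le_one_left (hq0 _) (hu j).2

lemma aux_total (D : Set S) (q : S → ℝ) (hq : HasSum q 1) :
    (∑' j : D, q j) + ∑' j : {j : S // j ∉ D}, q j = 1 := by
  have := hq.summable.tsum_subtype_add_tsum_subtype_compl D
  rw [hq.tsum_eq] at this
  exact this

lemma Ta_mono (D : Set S) (p : S → ((k : Fin N) → α k) → S → ℝ)
    (r : (k : Fin N) → S → ((k : Fin N) → α k) → ℚ) (k : Fin N)
    (u v : {j : S // j ∉ D} → (Fin N → ℚ) → ℝ)
    (hu : ∀ j m, u j m ∈ Set.Icc (0:ℝ) 1) (hv : ∀ j m, v j m ∈ Set.Icc (0:ℝ) 1)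
    (huv : ∀ j m, u j m ≤ v j m)
    (i : {j : S // j ∉ D}) (lam : Fin N → ℚ) (a : (k : Fin N) → α k)
    (hp0 : ∀ j, 0 ≤ p i a j) (hp : HasSum (p i a) 1) :
    Ta D p r k u i lam a ≤ Ta D p r k v i lam a := by
  unfold Ta
  gcongr with j
  · exact aux_summable D _ hp0 hp _ (fun j => hu j _)
  · exact aux_summable D _ hp0 hp _ (fun j => hv j _)
  · exact hp0 _
  · exact huv _ _

lemma Ta_mem (D : Set S) (p : S → ((k : Fin N) → α k) → S → ℝ)
    (r : (k : Fin N) → S → ((k : Fin N) → α k) → ℚ) (k : Fin N)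
    (u : {j : S // j ∉ D} → (Fin N → ℚ) → ℝ)
    (hu : ∀ j m, u j m ∈ Set.Icc (0:ℝ) 1)
    (i : {j : S // j ∉ D}) (lam : Fin N → ℚ) (a : (k : Fin N) → α k)
    (hp0 : ∀ j, 0 ≤ p i a j) (hp : HasSum (p i a) 1) :
    Ta D p r k u i lam a ∈ Set.Icc (0:ℝ) 1 := by
  have hD : 0 ≤ ∑' j : D, p i a j := tsum_nonneg fun j => hp0 _
  constructor
  · unfold Ta
    refine add_nonneg (mul_nonneg (by split_ifs <;> norm_num) hD)
      (tsum_nonneg fun j => mul_nonneg (hu _ _).1 (hp0 _))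
  · refine (Ta_mono D p r k u (fun _ _ => 1) hu (fun _ _ => by simp) (fun j m => (hu j m).2)
      i lam a hp0 hp).trans ?_
    refine le_trans ?_ (aux_total D _ hp).le
    unfold Ta
    simp only [one_mul]
    gcongr
    exact mul_le_of_le_one_left hD (by split_ifs <;> norm_num)

lemma Ta_neg (D : Set S) (p : S → ((k : Fin N) → α k) → S → ℝ)
    (r : (k : Fin N) → S → ((k : Fin N) → α k) → ℚ) (k : Fin N)
    (hr : ∀ l i a, 0 ≤ r l i a)
    (u : {j : S // j ∉ D} → (Fin N → ℚ) → ℝ)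
    (hu : ∀ j m, m k < 0 → u j m = 1)
    (i : {j : S // j ∉ D}) (lam : Fin N → ℚ) (hl : lam k < 0) (a : (k : Fin N) → α k)
    (hp : HasSum (p i a) 1) :
    Ta D p r k u i lam a = 1 := by
  unfold Ta
  rw [if_pos (hl.le.trans (hr _ _ _))]
  have : ∀ j, u j (fun l => lam l - r l (i : S) a) = 1 := fun j =>
    hu _ _ (by have := hr k i a; show lam k - r k i a < 0; linarith)
  simp only [this, one_mul]
  exact aux_total D _ hp

variable [∀ k, DecidableEq (α k)]

lemma prod_sum_one (B : (l : Fin N) → Finset (α l)) (phi : (l : Fin N) → α l → ℝ)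
    (h1 : ∀ l, ∑ a ∈ B l, phi l a = 1) :
    ∑ a ∈ Fintype.piFinset B, ∏ l, phi l (a l) = 1 := by
  rw [← Finset.prod_univ_sum]
  simp [h1]

lemma prod_update (k : Fin N) (R : (l : Fin N) → α l → ℝ) (φ : α k → ℝ)
    (a : (l : Fin N) → α l) :
    ∏ l, Function.update R k φ l (a l) = φ (a k) * ∏ l ∈ Finset.univ.erase k, R l (a l) := by
  rw [← Finset.mul_prod_erase Finset.univ _ (Finset.mem_univ k)]
  congr 1
  · simp
  · refine Finset.prod_congr rfl fun l hl => ?_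
    rw [Function.update_of_ne (Finset.ne_of_mem_erase hl)]

lemma Tphi_lin (D : Set S) (A : S → (k : Fin N) → Finset (α k))
    (p : S → ((k : Fin N) → α k) → S → ℝ)
    (r : (k : Fin N) → S → ((k : Fin N) → α k) → ℚ) (k : Fin N)
    (R : (l : Fin N) → α l → ℝ) (φ : α k → ℝ)
    (u : {j : S // j ∉ D} → (Fin N → ℚ) → ℝ)
    (i : {j : S // j ∉ D}) (lam : Fin N → ℚ) :
    Tphi D A p r k (Function.update R k φ) u i lam =
      ∑ b ∈ A i k, φ b * Tphi D A p r k
        (Function.update R k (fun a => if a = b then (1:ℝ) else 0)) u i lam := by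
  unfold Tphi
  simp only [prod_update, Finset.mul_sum]
  rw [Finset.sum_comm]
  refine Finset.sum_congr rfl fun a ha => ?_
  rw [Finset.sum_eq_single (a k)]
  · simp; ring
  · intro b _ hb
    simp [hb.symm]
  · intro h
    exact absurd (Fintype.mem_piFinset.1 ha k) h

end Helpers

/-- Existence part of Theorem 2(a): under the divergence condition on `(β n)`, the system of
optimality equations for player `k` (given Markov decision rules of the other players) admits a
`[0,1]`-valued solution equal to `1` on `{λ^k < 0}`, and the supremum over randomized decision
rules of player `k` is attained by a Dirac measure at some action `a* ∈ A_n^k(i)`. -/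
theorem stmt7 {S : Type*} [Countable S] {N : ℕ} (hN : 1 ≤ N)
    {α : Fin N → Type*} [∀ k, DecidableEq (α k)]
    (D : Set S)
    (A : ℕ → S → (k : Fin N) → Finset (α k))
    (hA : ∀ n i k, (A n i k).Nonempty)
    (p : ℕ → S → ((k : Fin N) → α k) → S → ℝ)
    (r : ℕ → (k : Fin N) → S → ((k : Fin N) → α k) → ℚ)
    (hp0 : ∀ n i a j, 0 ≤ p n i a j)
    (hp1 : ∀ n (i : S), i ∉ D → ∀ a, (∀ k, a k ∈ A n i k) → HasSum (p n i a) 1)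
    (hr : ∀ n k i a, 0 ≤ r n k i a)
    (k : Fin N)
    (rules : ℕ → (l : Fin N) → {j : S // j ∉ D} → (Fin N → ℚ) → α l → ℝ)
    (hrules0 : ∀ n l, l ≠ k → ∀ i lam a, 0 ≤ rules n l i lam a)
    (hrules1 : ∀ n l, l ≠ k → ∀ (i : {j : S // j ∉ D}) lam,
      ∑ a ∈ A n (i : S) l, rules n l i lam a = 1)
    (hrulessupp : ∀ n l, l ≠ k → ∀ (i : {j : S // j ∉ D}) lam a,
      a ∉ A n (i : S) l → rules n l i lam a = 0)
    (β : ℕ → ℝ) (hβ : ∀ n, 0 ≤ β n ∧ β n < 1)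
    (hβdiv : Filter.Tendsto (fun m => ∑ n ∈ Finset.range m, β n) Filter.atTop Filter.atTop)
    (hpD : ∀ n (i : S), i ∉ D → ∀ a, (∀ k, a k ∈ A n i k) →
      β n ≤ ∑' j : D, p n i a (j : S)) :
    ∃ u : ℕ → {j : S // j ∉ D} → (Fin N → ℚ) → ℝ,
      (∀ n j μ, u n j μ ∈ Set.Icc (0 : ℝ) 1) ∧
      (∀ n (j : {j : S // j ∉ D}) (μ : Fin N → ℚ), μ k < 0 → u n j μ = 1) ∧
      (∀ n (i : {j : S // j ∉ D}) (lam : Fin N → ℚ),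
        u n i lam = ⨆ φ : {φ : α k → ℝ // (∀ a, 0 ≤ φ a) ∧
            (∑ a ∈ A n (i : S) k, φ a = 1) ∧ (∀ a, a ∉ A n (i : S) k → φ a = 0)},
          Tphi D (A n) (p n) (r n) k
            (Function.update (fun l => rules n l i lam) k φ.1) (u (n + 1)) i lam) ∧
      (∀ n (i : {j : S // j ∉ D}) (lam : Fin N → ℚ),
        ∃ astar ∈ A n (i : S) k,
          u n i lam = Tphi D (A n) (p n) (r n) k
            (Function.update (fun l => rules n l i lam) k
              (fun a => if a = astar then (1 : ℝ) else 0)) (u (n + 1)) i lam) := by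
  classical
  have hdir0 : ∀ n (i : {j : S // j ∉ D}) lam b l a, 0 ≤ Function.update
      (fun l => rules n l i lam) k (fun a => if a = b then (1:ℝ) else 0) l a := by
    intro n i lam b l a
    by_cases h : l = k
    · subst h
      simp only [Function.update_self]
      split_ifs <;> norm_num
    · rw [Function.update_of_ne h]
      exact hrules0 n l h i lam a
  have hdir1 : ∀ n (i : {j : S // j ∉ D}) lam, ∀ b ∈ A n i k, ∀ l, ∑ a ∈ A n i l, Function.update
      (fun l => rules n l i lam) k (fun a => if a = b then (1:ℝ) else 0) l a = 1 := by
    intro n i lam b hb l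
    by_cases h : l = k
    · subst h
      simp [hb]
    · rw [Function.update_of_ne h]
      exact hrules1 n l h i lam
  have hpi : ∀ n (i : {j : S // j ∉ D}), ∀ a ∈ Fintype.piFinset (fun l => A n (i : S) l),
      HasSum (p n i a) 1 := fun n i a ha => hp1 n i i.2 a (Fintype.mem_piFinset.1 ha)
  -- the Dirac values
  let V : ({j : S // j ∉ D} → (Fin N → ℚ) → ℝ) → (n : ℕ) → (i : {j : S // j ∉ D}) →
      (Fin N → ℚ) → α k → ℝ := fun u n i lam b =>
    Tphi D (A n) (p n) (r n) k (Function.update (fun l => rules n l i lam) k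
      (fun a => if a = b then (1 : ℝ) else 0)) u i lam
  have hVmem : ∀ u : {j : S // j ∉ D} → (Fin N → ℚ) → ℝ, (∀ j m, u j m ∈ Set.Icc (0:ℝ) 1) →
      ∀ n (i : {j : S // j ∉ D}) lam, ∀ b ∈ A n i k, V u n i lam b ∈ Set.Icc (0:ℝ) 1 := by
    intro u hu n i lam b hb
    have hT := fun a ha => Ta_mem D (p n) (r n) k u hu i lam a (hp0 n i a) (hpi n i a ha)
    constructor
    · exact Finset.sum_nonneg fun a ha => mul_nonneg (hT a ha).1
        (Finset.prod_nonneg fun l _ => hdir0 n i lam b l _)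
    · rw [← prod_sum_one _ _ (hdir1 n i lam b hb)]
      exact Finset.sum_le_sum fun a ha => mul_le_of_le_one_left
        (Finset.prod_nonneg fun l _ => hdir0 n i lam b l _) (hT a ha).2
  have hVmono : ∀ u v : {j : S // j ∉ D} → (Fin N → ℚ) → ℝ,
      (∀ j m, u j m ∈ Set.Icc (0:ℝ) 1) → (∀ j m, v j m ∈ Set.Icc (0:ℝ) 1) →
      (∀ j m, u j m ≤ v j m) → ∀ n i lam b, V u n i lam b ≤ V v n i lam b := by
    intro u v hu hv huv n i lam b
    exact Finset.sum_le_sum fun a ha => mul_le_mul_of_nonneg_right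
      (Ta_mono D (p n) (r n) k u v hu hv huv i lam a (hp0 n i a) (hpi n i a ha))
      (Finset.prod_nonneg fun l _ => hdir0 n i lam b l _)
  have hVneg : ∀ u : {j : S // j ∉ D} → (Fin N → ℚ) → ℝ, (∀ j m, m k < 0 → u j m = 1) →
      ∀ n (i : {j : S // j ∉ D}) lam, lam k < 0 → ∀ b ∈ A n i k, V u n i lam b = 1 := by
    intro u hu n i lam hl b hb
    rw [← prod_sum_one _ _ (hdir1 n i lam b hb)]
    refine Finset.sum_congr rfl fun a ha => ?_
    rw [Ta_neg D (p n) (r n) k (hr n) u hu i lam hl a (hpi n i a ha), one_mul]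
  let F : (ℕ → {j : S // j ∉ D} → (Fin N → ℚ) → unitInterval) →o
      (ℕ → {j : S // j ∉ D} → (Fin N → ℚ) → unitInterval) :=
    { toFun := fun u n i lam => ⟨(A n i k).sup' (hA n i k)
        (V (fun j m => (u (n+1) j m : ℝ)) n i lam), by
          obtain ⟨b, hb, h⟩ := Finset.exists_mem_eq_sup' (hA n i k)
            (V (fun j m => (u (n+1) j m : ℝ)) n i lam)
          rw [h]
          exact hVmem _ (fun j m => (u (n+1) j m).2) n i lam b hb⟩
      monotone' := by
        intro u v huv n i lam
        refine Subtype.coe_le_coe.1 ?_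
        exact Finset.sup'_mono_fun (hs := hA n i k) fun b _ => hVmono _ _ (fun j m => (u (n+1) j m).2)
          (fun j m => (v (n+1) j m).2) (fun j m => huv (n+1) j m) n i lam b }
  let w := OrderHom.gfp F
  have hw : F w = w := OrderHom.map_gfp F
  have hw' : ∀ n i lam, (w n i lam : ℝ) = (A n i k).sup' (hA n i k)
        (V (fun j m => (w (n+1) j m : ℝ)) n i lam) := by
    intro n i lam
    conv_lhs => rw [← hw]
    rfl
  have hstar : ∀ n (i : {j : S // j ∉ D}) lam, ∃ b ∈ A n i k,
      (w n i lam : ℝ) = V (fun j m => (w (n+1) j m : ℝ)) n i lam b := by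
    intro n i lam
    rw [hw']
    exact Finset.exists_mem_eq_sup' _ _
  refine ⟨fun n i lam => (w n i lam : ℝ), fun n j m => (w n j m).2, ?_, ?_, hstar⟩
  · intro n j m hm
    let u0 : ℕ → {j : S // j ∉ D} → (Fin N → ℚ) → unitInterval :=
      fun _ _ m => if m k < 0 then 1 else 0
    have h0 : u0 ≤ F u0 := by
      intro n i lam
      by_cases hl : lam k < 0
      · obtain ⟨b, hb⟩ := hA n i k
        refine Subtype.coe_le_coe.1 ?_
        refine (u0 n i lam).2.2.trans ?_
        rw [← hVneg (fun j m => (u0 (n+1) j m : ℝ)) (fun j m hm => by simp [u0, hm]) n i lam hl b hb]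
        exact Finset.le_sup' (V (fun j m => (u0 (n+1) j m : ℝ)) n i lam) hb
      · have : u0 n i lam = 0 := by simp [u0, hl]
        rw [this]
        exact (F u0 n i lam).2.1
    have h1 : u0 ≤ w := OrderHom.le_gfp F h0
    have h2 : ((u0 n j m : unitInterval) : ℝ) ≤ w n j m := h1 n j m
    have h3 : ((u0 n j m : unitInterval) : ℝ) = 1 := by simp [u0, hm]
    exact le_antisymm (w n j m).2.2 (h3 ▸ h2)
  · intro n i lam
    have hub : ∀ φ : {φ : α k → ℝ // (∀ a, 0 ≤ φ a) ∧
            (∑ a ∈ A n (i : S) k, φ a = 1) ∧ (∀ a, a ∉ A n (i : S) k → φ a = 0)},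
          Tphi D (A n) (p n) (r n) k
            (Function.update (fun l => rules n l i lam) k φ.1)
            (fun j m => (w (n+1) j m : ℝ)) i lam ≤ w n i lam := by
      rintro ⟨φ, h0, h1, -⟩
      rw [Tphi_lin]
      calc _ ≤ ∑ b ∈ A n i k, φ b * (w n i lam : ℝ) := by
            refine Finset.sum_le_sum fun b hb => mul_le_mul_of_nonneg_left ?_ (h0 b)
            rw [hw' n i lam]
            exact Finset.le_sup' (V (fun j m => (w (n+1) j m : ℝ)) n i lam) hb
        _ = w n i lam := by rw [← Finset.sum_mul, h1, one_mul]
    obtain ⟨b, hb, h⟩ := hstar n i lam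
    let φ0 : {φ : α k → ℝ // (∀ a, 0 ≤ φ a) ∧
            (∑ a ∈ A n (i : S) k, φ a = 1) ∧ (∀ a, a ∉ A n (i : S) k → φ a = 0)} :=
      ⟨fun a => if a = b then (1 : ℝ) else 0, fun a => by dsimp only; split_ifs <;> norm_num,
        by simp [hb], fun a ha => if_neg (fun (hab : a = b) => ha (hab ▸ hb))⟩
    have : Nonempty {φ : α k → ℝ // (∀ a, 0 ≤ φ a) ∧
            (∑ a ∈ A n (i : S) k, φ a = 1) ∧ (∀ a, a ∉ A n (i : S) k → φ a = 0)} := ⟨φ0⟩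
    refine le_antisymm ?_ (ciSup_le hub)
    refine (le_of_eq h).trans ?_
    exact le_ciSup (f := fun φ : {φ : α k → ℝ // (∀ a, 0 ≤ φ a) ∧
            (∑ a ∈ A n (i : S) k, φ a = 1) ∧ (∀ a, a ∉ A n (i : S) k → φ a = 0)} =>
          Tphi D (A n) (p n) (r n) k
            (Function.update (fun l => rules n l i lam) k φ.1)
            (fun j m => (w (n+1) j m : ℝ)) i lam)
      ⟨_, Set.forall_mem_range.2 hub⟩ φ0
end

section
/- In the setting above, fix a player index k ∈ {1,…,N} and, for each l ≠ k, each n ∈ ℕ and each (i,λ) ∈ (S∖D) × ℚ^N, a probability mass function φ_n^l(·∣i,λ) on A_n^l(i) (a Markov decision rule for player l). Assume there exists β > 0 with p_n(D∣i,𝐚) ≥ β for all n, all i ∈ S∖D and all 𝐚 ∈ 𝐀_n(i). Then any two sequences (u_n)_{n∈ℕ} and (v_n)_{n∈ℕ} of [0,1]-valued functions on (S∖D) × ℚ^N that both satisfy, for all n and (i,λ), the optimality equation u_n(i,λ) = sup over probability mass functions φ on A_n^k(i) of T_{n,k}^{[φ_n^{−k}(·∣i,λ), φ]} u_{n+1}(i,λ),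 must coincide: u_n = v_n for all n. -/
open scoped BigOperators

lemma Ta_le_aux {S : Type*} {N : ℕ} {α : Fin N → Type*} (D : Set S)
    (p : S → ((k : Fin N) → α k) → S → ℝ)
    (r : (k : Fin N) → S → ((k : Fin N) → α k) → ℚ)
    (k : Fin N) (u v : {j : S // j ∉ D} → (Fin N → ℚ) → ℝ)
    (hu : ∀ j μ, u j μ ∈ Set.Icc (0 : ℝ) 1) (hv : ∀ j μ, v j μ ∈ Set.Icc (0 : ℝ) 1)
    (i : {j : S // j ∉ D}) (lam : Fin N → ℚ) (a : (k : Fin N) → α k)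
    (hp0 : ∀ j, 0 ≤ p i a j) (hp1 : HasSum (p i a) 1)
    (β C : ℝ) (hC : 0 ≤ C) (hβ : β ≤ ∑' j : D, p i a (j : S))
    (huv : ∀ j μ, u j μ ≤ v j μ + C) :
    Ta D p r k u i lam a ≤ Ta D p r k v i lam a + (1 - β) * C ∧ Ta D p r k v i lam a ≤ 1 := by
  have hsum := hp1.summable.tsum_subtype_add_tsum_subtype_compl D
  rw [hp1.tsum_eq] at hsum
  have hs : Summable (fun j : {j : S // j ∉ D} => p i a (j : S)) := hp1.summable.subtype Dᶜ
  change _ + (∑' j : {j : S // j ∉ D}, p i a (j : S)) = 1 at hsum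
  have hsw : ∀ w : {j : S // j ∉ D} → (Fin N → ℚ) → ℝ, (∀ j μ, w j μ ∈ Set.Icc (0 : ℝ) 1) →
      Summable (fun j : {j : S // j ∉ D} => w j (fun l => lam l - r l i a) * p i a (j : S)) := by
    intro w hw
    refine Summable.of_nonneg_of_le (fun j => mul_nonneg (hw _ _).1 (hp0 _)) (fun j => ?_) hs
    exact mul_le_of_le_one_left (hp0 _) (hw _ _).2
  have hD0 : 0 ≤ ∑' j : D, p i a (j : S) := tsum_nonneg fun j => hp0 _
  constructor
  · have h1 : (∑' j : {j : S // j ∉ D}, u j (fun l => lam l - r l i a) * p i a (j : S)) ≤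
        ∑' j : {j : S // j ∉ D}, (v j (fun l => lam l - r l i a) * p i a (j : S)
          + C * p i a (j : S)) := by
      refine (hsw u hu).tsum_le_tsum (fun j => ?_) ((hsw v hv).add (hs.mul_left C))
      rw [← add_mul]
      exact mul_le_mul_of_nonneg_right (huv _ _) (hp0 _)
    rw [(hsw v hv).tsum_add (hs.mul_left C), tsum_mul_left] at h1
    unfold Ta
    nlinarith
  · have h1 : (∑' j : {j : S // j ∉ D}, v j (fun l => lam l - r l i a) * p i a (j : S)) ≤
        ∑' j : {j : S // j ∉ D}, p i a (j : S) :=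
      (hsw v hv).tsum_le_tsum (fun j => mul_le_of_le_one_left (hp0 _) (hv _ _).2) hs
    unfold Ta
    split_ifs <;> linarith

lemma one_sided_aux {S : Type*} {N : ℕ}
    {α : Fin N → Type*} [∀ k, DecidableEq (α k)]
    (D : Set S)
    (A : ℕ → S → (k : Fin N) → Finset (α k))
    (hA : ∀ n i k, (A n i k).Nonempty)
    (p : ℕ → S → ((k : Fin N) → α k) → S → ℝ)
    (r : ℕ → (k : Fin N) → S → ((k : Fin N) → α k) → ℚ)
    (hp0 : ∀ n i a j, 0 ≤ p n i a j)
    (hp1 : ∀ n (i : S), i ∉ D → ∀ a, (∀ k, a k ∈ A n i k) → HasSum (p n i a) 1)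
    (k : Fin N)
    (rules : ℕ → (l : Fin N) → {j : S // j ∉ D} → (Fin N → ℚ) → α l → ℝ)
    (hrules0 : ∀ n l, l ≠ k → ∀ i lam a, 0 ≤ rules n l i lam a)
    (hrules1 : ∀ n l, l ≠ k → ∀ (i : {j : S // j ∉ D}) lam,
      ∑ a ∈ A n (i : S) l, rules n l i lam a = 1)
    (β : ℝ) (hβ : 0 < β)
    (hpD : ∀ n (i : S), i ∉ D → ∀ a, (∀ k, a k ∈ A n i k) →
      β ≤ ∑' j : D, p n i a (j : S))
    (u v : ℕ → {j : S // j ∉ D} → (Fin N → ℚ) → ℝ)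
    (hu01 : ∀ n j μ, u n j μ ∈ Set.Icc (0 : ℝ) 1)
    (hv01 : ∀ n j μ, v n j μ ∈ Set.Icc (0 : ℝ) 1)
    (hueq : ∀ n (i : {j : S // j ∉ D}) (lam : Fin N → ℚ),
      u n i lam = ⨆ φ : {φ : α k → ℝ // (∀ a, 0 ≤ φ a) ∧
          (∑ a ∈ A n (i : S) k, φ a = 1) ∧ (∀ a, a ∉ A n (i : S) k → φ a = 0)},
        Tphi D (A n) (p n) (r n) k
          (Function.update (fun l => rules n l i lam) k φ.1) (u (n + 1)) i lam)
    (hveq : ∀ n (i : {j : S // j ∉ D}) (lam : Fin N → ℚ),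
      v n i lam = ⨆ φ : {φ : α k → ℝ // (∀ a, 0 ≤ φ a) ∧
          (∑ a ∈ A n (i : S) k, φ a = 1) ∧ (∀ a, a ∉ A n (i : S) k → φ a = 0)},
        Tphi D (A n) (p n) (r n) k
          (Function.update (fun l => rules n l i lam) k φ.1) (v (n + 1)) i lam) :
    ∀ n j μ, u n j μ ≤ v n j μ := by
  intro n j μ
  have hβ1 : β ≤ 1 := by
    choose a ha using fun k => hA n j k
    have h1 := hpD n j j.2 a ha
    have hs := hp1 n j j.2 a ha
    have h2 := hs.summable.tsum_subtype_le _ D (hp0 n j a)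
    rw [hs.tsum_eq] at h2
    exact h1.trans h2
  have key : ∀ m n i lam, u n i lam ≤ v n i lam + (1 - β) ^ m := by
    intro m
    induction m with
    | zero =>
      intro n i lam
      have h1 := (hu01 n i lam).2
      have h2 := (hv01 n i lam).1
      simp; linarith
    | succ m ih =>
      intro n i lam
      have hC : 0 ≤ (1 - β) ^ m := pow_nonneg (by linarith) m
      have hTa : ∀ a ∈ Fintype.piFinset (fun l => A n (i : S) l), _ := fun a ha =>
        Ta_le_aux D (p n) (r n) k (u (n+1)) (v (n+1)) (hu01 _) (hv01 _) i lam a (hp0 n i a)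
          (hp1 n i i.2 a (Fintype.mem_piFinset.1 ha)) β _ hC
          (hpD n i i.2 a (Fintype.mem_piFinset.1 ha)) (ih (n+1))
      have hφ : ∀ φ : {φ : α k → ℝ // (∀ a, 0 ≤ φ a) ∧
          (∑ a ∈ A n (i : S) k, φ a = 1) ∧ (∀ a, a ∉ A n (i : S) k → φ a = 0)},
          (∀ l a, 0 ≤ Function.update (fun l => rules n l i lam) k φ.1 l a) ∧
          ∑ a ∈ Fintype.piFinset (fun l => A n (i : S) l),
            ∏ l, Function.update (fun l => rules n l i lam) k φ.1 l (a l) = 1 := by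
        intro φ
        constructor
        · intro l a
          by_cases h : l = k
          · subst h; simpa using φ.2.1 a
          · simpa [h] using hrules0 n l h i lam a
        · rw [← Finset.prod_univ_sum (fun l => A n (i : S) l)
            (Function.update (fun l => rules n l i lam) k φ.1)]
          refine Finset.prod_eq_one fun l _ => ?_
          by_cases h : l = k
          · subst h; simpa using φ.2.2.1
          · simpa [h] using hrules1 n l h i lam
      obtain ⟨a0, ha0⟩ := hA n i k
      have : Nonempty {φ : α k → ℝ // (∀ a, 0 ≤ φ a) ∧
          (∑ a ∈ A n (i : S) k, φ a = 1) ∧ (∀ a, a ∉ A n (i : S) k → φ a = 0)} := by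
        refine ⟨fun a => if a = a0 then 1 else 0, fun a => ?_, ?_, fun a ha => ?_⟩
        · dsimp only; split_ifs <;> norm_num
        · simp [ha0]
        · have : a ≠ a0 := fun h => ha (h ▸ ha0)
          simp [this]
      rw [hueq n i lam]
      refine ciSup_le fun φ => ?_
      obtain ⟨hn, h1⟩ := hφ φ
      have hstep : Tphi D (A n) (p n) (r n) k
          (Function.update (fun l => rules n l i lam) k φ.1) (u (n + 1)) i lam ≤
          Tphi D (A n) (p n) (r n) k
          (Function.update (fun l => rules n l i lam) k φ.1) (v (n + 1)) i lam
          + (1 - β) ^ (m + 1) := by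
        unfold Tphi
        generalize Function.update (fun l => rules n l i lam) k φ.1 = f at hn h1 ⊢
        have h2 := congrArg (fun x => (1 - β) ^ (m + 1) * x) h1
        simp only [mul_one] at h2
        rw [← h2, Finset.mul_sum, ← Finset.sum_add_distrib]
        refine Finset.sum_le_sum fun a ha => ?_
        rw [← add_mul, pow_succ']
        exact mul_le_mul_of_nonneg_right (hTa a ha).1 (Finset.prod_nonneg fun l _ => hn l _)
      refine hstep.trans (add_le_add_left ?_ _)
      rw [hveq n i lam]
      refine le_ciSup (f := fun φ : {φ : α k → ℝ // (∀ a, 0 ≤ φ a) ∧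
          (∑ a ∈ A n (i : S) k, φ a = 1) ∧ (∀ a, a ∉ A n (i : S) k → φ a = 0)} =>
          Tphi D (A n) (p n) (r n) k
          (Function.update (fun l => rules n l i lam) k φ.1) (v (n + 1)) i lam) ⟨1, ?_⟩ φ
      rintro _ ⟨ψ, rfl⟩
      obtain ⟨hn, h1⟩ := hφ ψ
      dsimp only
      unfold Tphi
      refine le_trans ?_ h1.le
      refine Finset.sum_le_sum fun a ha => ?_
      exact mul_le_of_le_one_left (Finset.prod_nonneg fun l _ => hn l _) (hTa a ha).2
  have hlim : Filter.Tendsto (fun m : ℕ => v n j μ + (1 - β) ^ m) Filter.atTop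
      (nhds (v n j μ + 0)) :=
    (tendsto_pow_atTop_nhds_zero_of_lt_one (by linarith) (by linarith)).const_add _
  rw [add_zero] at hlim
  exact ge_of_tendsto' hlim fun m => key m n j μ

/-- Uniqueness part of Theorem 2(a) under Assumption B (`p_n(D∣i,𝐚) ≥ β > 0`): any two
`[0,1]`-valued sequences of functions on `(S∖D) × ℚ^N` satisfying the optimality equations
for player `k` (given Markov decision rules of the other players) coincide. -/
theorem stmt8 {S : Type*} [Countable S] {N : ℕ} (hN : 1 ≤ N)
    {α : Fin N → Type*} [∀ k, DecidableEq (α k)]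
    (D : Set S)
    (A : ℕ → S → (k : Fin N) → Finset (α k))
    (hA : ∀ n i k, (A n i k).Nonempty)
    (p : ℕ → S → ((k : Fin N) → α k) → S → ℝ)
    (r : ℕ → (k : Fin N) → S → ((k : Fin N) → α k) → ℚ)
    (hp0 : ∀ n i a j, 0 ≤ p n i a j)
    (hp1 : ∀ n (i : S), i ∉ D → ∀ a, (∀ k, a k ∈ A n i k) → HasSum (p n i a) 1)
    (hr : ∀ n k i a, 0 ≤ r n k i a)
    (k : Fin N)
    (rules : ℕ → (l : Fin N) → {j : S // j ∉ D} → (Fin N → ℚ) → α l → ℝ)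
    (hrules0 : ∀ n l, l ≠ k → ∀ i lam a, 0 ≤ rules n l i lam a)
    (hrules1 : ∀ n l, l ≠ k → ∀ (i : {j : S // j ∉ D}) lam,
      ∑ a ∈ A n (i : S) l, rules n l i lam a = 1)
    (hrulessupp : ∀ n l, l ≠ k → ∀ (i : {j : S // j ∉ D}) lam a,
      a ∉ A n (i : S) l → rules n l i lam a = 0)
    (β : ℝ) (hβ : 0 < β)
    (hpD : ∀ n (i : S), i ∉ D → ∀ a, (∀ k, a k ∈ A n i k) →
      β ≤ ∑' j : D, p n i a (j : S))
    (u v : ℕ → {j : S // j ∉ D} → (Fin N → ℚ) → ℝ)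
    (hu01 : ∀ n j μ, u n j μ ∈ Set.Icc (0 : ℝ) 1)
    (hv01 : ∀ n j μ, v n j μ ∈ Set.Icc (0 : ℝ) 1)
    (hueq : ∀ n (i : {j : S // j ∉ D}) (lam : Fin N → ℚ),
      u n i lam = ⨆ φ : {φ : α k → ℝ // (∀ a, 0 ≤ φ a) ∧
          (∑ a ∈ A n (i : S) k, φ a = 1) ∧ (∀ a, a ∉ A n (i : S) k → φ a = 0)},
        Tphi D (A n) (p n) (r n) k
          (Function.update (fun l => rules n l i lam) k φ.1) (u (n + 1)) i lam)
    (hveq : ∀ n (i : {j : S // j ∉ D}) (lam : Fin N → ℚ),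
      v n i lam = ⨆ φ : {φ : α k → ℝ // (∀ a, 0 ≤ φ a) ∧
          (∑ a ∈ A n (i : S) k, φ a = 1) ∧ (∀ a, a ∉ A n (i : S) k → φ a = 0)},
        Tphi D (A n) (p n) (r n) k
          (Function.update (fun l => rules n l i lam) k φ.1) (v (n + 1)) i lam) :
    ∀ n j μ, u n j μ = v n j μ := by
  intro n j μ
  exact le_antisymm
    (one_sided_aux D A hA p r hp0 hp1 k rules hrules0 hrules1 β hβ hpD u v hu01 hv01 hueq hveq n j μ)
    (one_sided_aux D A hA p r hp0 hp1 k rules hrules0 hrules1 β hβ hpD v u hv01 hu01 hveq hueq n j μ)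
end

section
/- Let (X_n)_{n∈ℕ} be a sequence of nonempty types, let β ∈ (0,1], and for each n let T_n : 𝒰_{n+1} → 𝒰_n be (1−β)-Lipschitz: d(T_n f, T_n g) ≤ (1−β)·d(f,g). Let (F_n) with F_n ∈ 𝒰_n satisfy F_n = T_n F_{n+1} for all n. Let (u_n^0) with u_n^0 ∈ 𝒰_n be arbitrary, and define u_n^{m+1} := T_n u_{n+1}^m for all n, m. Then for all n ∈ ℕ and m ∈ ℕ, d(u_n^m, F_n) ≤ ∑_{t=m}^∞ (1−β)^t = (1−β)^m / β. -/
/-- Abstract form of Lemma 2: if each `T n` is `(1-β)`-Lipschitz with `β ∈ (0,1]`, `(F n)` is a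
fixed sequence (`F n = T n (F (n+1))`), and `u^{m+1}_n = T n u^m_{n+1}` for an arbitrary initial
sequence `u^0`, then `d(u^m_n, F_n) ≤ (1-β)^m / β` (the value `∑_{t=m}^∞ (1-β)^t`). -/
theorem stmt9 (X : ℕ → Type*) [∀ n, Nonempty (X n)]
    (β : ℝ) (hβ0 : 0 < β) (hβ1 : β ≤ 1)
    (T : ∀ n, UnitBall (X (n + 1)) → UnitBall (X n))
    (hT : ∀ n (f g : UnitBall (X (n + 1))),
      supDist (T n f).1 (T n g).1 ≤ (1 - β) * supDist f.1 g.1)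
    (F : ∀ n, UnitBall (X n)) (hF : ∀ n, F n = T n (F (n + 1)))
    (u : ℕ → ∀ n, UnitBall (X n))
    (hrec : ∀ m n, u (m + 1) n = T n (u m (n + 1))) :
    ∀ n m, supDist (u m n).1 (F n).1 ≤ (1 - β) ^ m / β := by
  have key : ∀ m n, supDist (u m n).1 (F n).1 ≤ (1 - β) ^ m := by
    intro m
    induction m with
    | zero =>
      intro n
      rw [pow_zero]
      refine ciSup_le fun x => ?_
      have h1 := (u 0 n).2 x
      have h2 := (F n).2 x
      rw [abs_le]
      constructor <;> linarith [h1.1, h1.2, h2.1, h2.2]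
    | succ m ih =>
      intro n
      rw [hrec m n, hF n, pow_succ']
      exact (hT n _ _).trans (mul_le_mul_of_nonneg_left (ih (n + 1)) (by linarith))
  intro n m
  refine (key m n).trans ?_
  rw [le_div_iff₀ hβ0]
  exact mul_le_of_le_one_right (pow_nonneg (by linarith) m) hβ1
end
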